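/- There exist constants K > 0 and λ₀ > 0 such that for every λ ≥ λ₀ the following holds: if M : ℝ → ℝ is measurable, nondecreasing, satisfies the exponential parking equation with rate λ, and satisfies ⌈(x−1)/2⌉ ≤ M(x) ≤ ⌊x⌋ for all x > 0, and if C_λ = lim_{x→∞} M(x)/x and B_λ = lim_{x→∞} (M(x) − C_λ x), then |B_λ − (−1/2 + 1/(λ+1) + 1/(2(λ+1)²))| ≤ K e^{−λ}. -/

import Mathlib

open MeasureTheory Filter

/-- `M` satisfies the exponential parking equation with rate `lam`:
`M = 0` on `[0,1]` and for every `x > 0`,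
`M (x+1) = ∫₀ˣ (lam * e^{-lam t} / (1 - e^{-lam x})) * (M t + M (x - t)) dt + 1`. -/
def SatisfiesExpParkingEq (lam : ℝ) (M : ℝ → ℝ) : Prop :=
  (∀ x : ℝ, 0 ≤ x → x ≤ 1 → M x = 0) ∧
  ∀ x : ℝ, 0 < x →
    M (x + 1) = (∫ t in (0:ℝ)..x,
      (lam * Real.exp (-lam * t) / (1 - Real.exp (-lam * x))) * (M t + M (x - t))) + 1

/-- The convolution `∫₀ˣ lam e^{-lam (x-y)} M y dy`, with the factor `e^{-lam x}` pulled out. -/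
noncomputable def expConv (lam : ℝ) (M : ℝ → ℝ) (x : ℝ) : ℝ :=
  Real.exp (-lam * x) * ∫ y in (0:ℝ)..x, lam * Real.exp (lam * y) * M y

/-- The truncated expectation `∫₀ˣ lam e^{-lam t} M t dt`. -/
noncomputable def expMean (lam : ℝ) (M : ℝ → ℝ) (x : ℝ) : ℝ :=
  ∫ t in (0:ℝ)..x, lam * Real.exp (-lam * t) * M t

/-- The defect of `M` in the renewal equation `M (x+1) = 1 + expConv lam M x`. -/
noncomputable def renewalDefect (lam : ℝ) (M : ℝ → ℝ) (x : ℝ) : ℝ :=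
  M (x + 1) - 1 - expConv lam M x

theorem MonotoneOn.intervalIntegrable_of_nonneg {M : ℝ → ℝ} (hM : MonotoneOn M (Set.Ici 0))
    {a b : ℝ} (ha : 0 ≤ a) (hb : 0 ≤ b) : IntervalIntegrable M volume a b :=
  (hM.mono fun _ hx => (le_min ha hb).trans hx.1).intervalIntegrable

theorem intervalIntegrable_exp_mul {M : ℝ → ℝ} (hM : MonotoneOn M (Set.Ici 0)) (lam c : ℝ)
    {a b : ℝ} (ha : 0 ≤ a) (hb : 0 ≤ b) :
    IntervalIntegrable (fun y => lam * Real.exp (c * y) * M y) volume a b :=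
  (hM.intervalIntegrable_of_nonneg ha hb).continuousOn_mul (by fun_prop)

theorem continuousOn_expConv {M : ℝ → ℝ} (hM : MonotoneOn M (Set.Ici 0)) (lam : ℝ) {X : ℝ}
    (hX : 0 ≤ X) : ContinuousOn (expConv lam M) (Set.Icc 0 X) := by
  have h := intervalIntegral.continuousOn_primitive_interval' (a := 0)
    (intervalIntegrable_exp_mul hM lam lam le_rfl hX) (by simp)
  rw [Set.uIcc_of_le hX] at h
  exact ContinuousOn.mul (by fun_prop) h

theorem integral_expConv {M : ℝ → ℝ} (hmeas : Measurable M) (hM : MonotoneOn M (Set.Ici 0))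
    {lam X : ℝ} (hlam : lam ≠ 0) (hX : 0 ≤ X) :
    ∫ x in (0:ℝ)..X, expConv lam M x = (∫ x in (0:ℝ)..X, M x) - expConv lam M X / lam := by
  have hcont : ContinuousOn (fun x => (∫ y in (0:ℝ)..x, M y) - expConv lam M x / lam)
      (Set.Icc 0 X) := by
    have h := intervalIntegral.continuousOn_primitive_interval' (a := 0)
      (hM.intervalIntegrable_of_nonneg le_rfl hX) (by simp)
    rw [Set.uIcc_of_le hX] at h
    exact h.sub ((continuousOn_expConv hM lam hX).div_const _)
  have key := integral_eq_of_hasDerivAt_off_countable_of_le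
    (fun x => (∫ y in (0:ℝ)..x, M y) - expConv lam M x / lam) (expConv lam M) hX
    hM.countable_not_continuousWithinAt hcont ?_ ?_
  · rw [key]
    simp [expConv]
  · rintro x ⟨⟨hx0, hxX⟩, hx⟩
    have hc : ContinuousAt M x := by
      have : ContinuousWithinAt M (Set.Ici 0) x := by
        by_contra h
        exact hx ⟨hx0.le, h⟩
      exact this.continuousAt (Ici_mem_nhds hx0)
    have h1 : HasDerivAt (fun u => ∫ y in (0:ℝ)..u, M y) (M x) x :=
      intervalIntegral.integral_hasDerivAt_right
        (hM.intervalIntegrable_of_nonneg le_rfl hx0.le)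
        hmeas.stronglyMeasurable.stronglyMeasurableAtFilter hc
    have h2 : HasDerivAt (fun u => ∫ y in (0:ℝ)..u, lam * Real.exp (lam * y) * M y)
        (lam * Real.exp (lam * x) * M x) x :=
      intervalIntegral.integral_hasDerivAt_right
        (intervalIntegrable_exp_mul hM lam lam le_rfl hx0.le)
        (Measurable.stronglyMeasurable (by fun_prop)).stronglyMeasurableAtFilter
        (by fun_prop)
    have h3 : HasDerivAt (fun u => Real.exp (-lam * u)) (Real.exp (-lam * x) * (-lam)) x := by
      simpa using ((hasDerivAt_id x).const_mul (-lam)).exp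
    have h4 := h1.sub ((h3.mul h2).div_const lam)
    refine h4.congr_deriv ?_
    have he : Real.exp (-(lam * x)) * Real.exp (lam * x) = 1 := by
      rw [← Real.exp_add]; simp
    unfold expConv
    field_simp
    linear_combination (-M x) * he
  · refine ContinuousOn.intervalIntegrable ?_
    rw [Set.uIcc_of_le hX]
    exact continuousOn_expConv hM lam hX

theorem expConv_eq_integral_sub (lam : ℝ) (M : ℝ → ℝ) (x : ℝ) :
    expConv lam M x = ∫ t in (0:ℝ)..x, lam * Real.exp (-lam * t) * M (x - t) := by
  have h := intervalIntegral.integral_comp_sub_left (a := 0) (b := x)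
    (fun y => Real.exp (-lam * x) * (lam * Real.exp (lam * y) * M y)) x
  simp only [sub_self, sub_zero] at h
  rw [expConv, ← intervalIntegral.integral_const_mul, ← h]
  refine intervalIntegral.integral_congr fun t _ => ?_
  have : Real.exp (-lam * t) = Real.exp (-lam * x) * Real.exp (lam * (x - t)) := by
    rw [← Real.exp_add]; ring_nf
  simp only [this]
  ring

theorem SatisfiesExpParkingEq.renewalDefect_eq {lam : ℝ} {M : ℝ → ℝ}
    (h : SatisfiesExpParkingEq lam M) (hM : MonotoneOn M (Set.Ici 0)) (hlam : 0 < lam)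
    {x : ℝ} (hx : 0 < x) :
    renewalDefect lam M x = expMean lam M x + Real.exp (-lam * x) * (M (x + 1) - 1) := by
  have hd : 1 - Real.exp (-lam * x) ≠ 0 := by
    have : Real.exp (-lam * x) < 1 := Real.exp_zero ▸ Real.exp_lt_exp.mpr (by nlinarith)
    linarith
  have hi2 : IntervalIntegrable (fun t => lam * Real.exp (-lam * t) * M (x - t)) volume 0 x := by
    have h' := (hM.intervalIntegrable_of_nonneg hx.le le_rfl).comp_sub_left x
    simp only [sub_self, sub_zero] at h'
    exact h'.continuousOn_mul (by fun_prop)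
  have heq : (∫ t in (0:ℝ)..x,
      (lam * Real.exp (-lam * t) / (1 - Real.exp (-lam * x))) * (M t + M (x - t)))
      = (expMean lam M x + expConv lam M x) / (1 - Real.exp (-lam * x)) := by
    rw [expConv_eq_integral_sub, expMean, ← intervalIntegral.integral_add
      (intervalIntegrable_exp_mul hM lam (-lam) le_rfl hx.le) hi2,
      ← intervalIntegral.integral_div]
    refine intervalIntegral.integral_congr fun t _ => ?_
    ring
  have hp := h.2 x hx
  rw [heq] at hp
  have hp' : (M (x + 1) - 1) * (1 - Real.exp (-lam * x)) =
      expMean lam M x + expConv lam M x := by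
    rw [hp, add_sub_cancel_right, div_mul_cancel₀ _ hd]
  unfold renewalDefect
  linear_combination hp'

theorem expMean_eq_zero {lam : ℝ} {M : ℝ → ℝ} (h : ∀ x : ℝ, 0 ≤ x → x ≤ 1 → M x = 0)
    {x : ℝ} (hx0 : 0 ≤ x) (hx1 : x ≤ 1) : expMean lam M x = 0 := by
  refine intervalIntegral.integral_zero_ae (Eventually.of_forall fun t ht => ?_)
  rw [Set.uIoc_of_le hx0] at ht
  rw [h t ht.1.le (ht.2.trans hx1), mul_zero]

theorem SatisfiesExpParkingEq.renewalDefect_eq_zero {lam : ℝ} {M : ℝ → ℝ}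
    (h : SatisfiesExpParkingEq lam M) {x : ℝ} (hx0 : 0 < x) (hx1 : x ≤ 1) :
    renewalDefect lam M x = 0 := by
  have hM1 : M (x + 1) = 1 := by
    rw [h.2 x hx0, intervalIntegral.integral_zero_ae, zero_add]
    refine Eventually.of_forall fun t ht => ?_
    rw [Set.uIoc_of_le hx0.le] at ht
    rw [h.1 t ht.1.le (ht.2.trans hx1), h.1 (x - t) (by linarith [ht.2]) (by linarith [ht.1])]
    simp
  have hJ : expConv lam M x = 0 := by
    rw [expConv, intervalIntegral.integral_zero_ae, mul_zero]
    refine Eventually.of_forall fun t ht => ?_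
    rw [Set.uIoc_of_le hx0.le] at ht
    rw [h.1 t ht.1.le (ht.2.trans hx1), mul_zero]
  rw [renewalDefect, hM1, hJ]
  ring

theorem integral_exp_mul_id {lam : ℝ} (hlam : lam ≠ 0) (x y : ℝ) :
    ∫ t in x..y, lam * Real.exp (-lam * t) * t =
      Real.exp (-lam * x) * (x + 1 / lam) - Real.exp (-lam * y) * (y + 1 / lam) := by
  have hd : ∀ t : ℝ, HasDerivAt (fun u => -(Real.exp (-lam * u) * (u + 1 / lam)))
      (lam * Real.exp (-lam * t) * t) t := by
    intro t
    have h3 : HasDerivAt (fun u => Real.exp (-lam * u)) (Real.exp (-lam * t) * (-lam)) t := by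
      simpa using ((hasDerivAt_id t).const_mul (-lam)).exp
    refine (h3.mul ((hasDerivAt_id t).add_const (1 / lam))).neg.congr_deriv ?_
    simp only [id]
    field_simp
    ring
  rw [intervalIntegral.integral_eq_sub_of_hasDerivAt (fun t _ => hd t)
    (Continuous.intervalIntegrable (by fun_prop) _ _)]
  ring

theorem expMean_bounds {lam : ℝ} {M : ℝ → ℝ} (hlam : 0 < lam) (hM : MonotoneOn M (Set.Ici 0))
    (hb : ∀ t, 0 ≤ t → 0 ≤ M t ∧ M t ≤ t) {x y : ℝ} (hx : 0 ≤ x) (hxy : x ≤ y) :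
    expMean lam M x ≤ expMean lam M y ∧
      expMean lam M y ≤ expMean lam M x + Real.exp (-lam * x) * (x + 1 / lam) := by
  have hy := hx.trans hxy
  have hxyi := intervalIntegrable_exp_mul hM lam (-lam) hx hy
  have hadd : expMean lam M x + ∫ t in x..y, lam * Real.exp (-lam * t) * M t =
      expMean lam M y :=
    intervalIntegral.integral_add_adjacent_intervals
      (intervalIntegrable_exp_mul hM lam (-lam) le_rfl hx) hxyi
  have h0 : 0 ≤ ∫ t in x..y, lam * Real.exp (-lam * t) * M t := by
    refine intervalIntegral.integral_nonneg hxy fun t ht => ?_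
    have := (hb t (hx.trans ht.1)).1
    positivity
  have h1 : ∫ t in x..y, lam * Real.exp (-lam * t) * M t ≤
      ∫ t in x..y, lam * Real.exp (-lam * t) * t := by
    refine intervalIntegral.integral_mono_on hxy hxyi
      (Continuous.intervalIntegrable (by fun_prop) _ _) fun t ht => ?_
    have := (hb t (hx.trans ht.1)).2
    gcongr
  rw [integral_exp_mul_id hlam.ne'] at h1
  have h2 : 0 ≤ Real.exp (-lam * y) * (y + 1 / lam) := by positivity
  constructor <;> linarith

theorem exists_expMean_limit {lam : ℝ} {M : ℝ → ℝ} (hlam : 0 < lam)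
    (hM : MonotoneOn M (Set.Ici 0)) (hb : ∀ t, 0 ≤ t → 0 ≤ M t ∧ M t ≤ t) :
    ∃ a : ℝ, ∀ x, 0 ≤ x → expMean lam M x ≤ a ∧
      a ≤ expMean lam M x + Real.exp (-lam * x) * (x + 1 / lam) := by
  have hbdd : BddAbove (expMean lam M '' Set.Ici 0) := by
    refine ⟨expMean lam M 0 + Real.exp (-lam * 0) * (0 + 1 / lam), ?_⟩
    rintro _ ⟨x, hx, rfl⟩
    exact (expMean_bounds hlam hM hb le_rfl hx).2
  refine ⟨sSup (expMean lam M '' Set.Ici 0), fun x hx => ⟨le_csSup hbdd ⟨x, hx, rfl⟩, ?_⟩⟩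
  refine csSup_le ⟨_, x, hx, rfl⟩ ?_
  rintro _ ⟨y, hy, rfl⟩
  rcases le_total x y with hxy | hxy
  · exact (expMean_bounds hlam hM hb hx hxy).2
  · have := (expMean_bounds hlam hM hb hy hxy).1
    have : 0 ≤ Real.exp (-lam * x) * (x + 1 / lam) := by positivity
    linarith

theorem exp_neg_mul_le {lam x : ℝ} (hlam : 1 ≤ lam) (hx : 1 ≤ x) :
    Real.exp (-lam * x) * (2 * x + 2) ≤
      4 * Real.exp (-lam) * Real.exp (-(x - 1) / 2) := by
  have h1 : Real.exp (-lam * x) ≤ Real.exp (-lam) * Real.exp (-(x - 1)) := by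
    rw [← Real.exp_add]
    exact Real.exp_le_exp.mpr (by nlinarith)
  have h2 : 2 * x + 2 ≤ 4 * Real.exp ((x - 1) / 2) := by
    have := Real.add_one_le_exp ((x - 1) / 2)
    linarith
  calc Real.exp (-lam * x) * (2 * x + 2)
      ≤ (Real.exp (-lam) * Real.exp (-(x - 1))) * (4 * Real.exp ((x - 1) / 2)) := by gcongr
    _ = 4 * Real.exp (-lam) * (Real.exp (-(x - 1)) * Real.exp ((x - 1) / 2)) := by ring
    _ = _ := by rw [← Real.exp_add]; ring_nf

theorem SatisfiesExpParkingEq.abs_renewalDefect_sub_le {lam a : ℝ} {M : ℝ → ℝ}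
    (h : SatisfiesExpParkingEq lam M) (hM : MonotoneOn M (Set.Ici 0)) (hlam : 1 ≤ lam)
    (hb : ∀ t, 0 ≤ t → 0 ≤ M t ∧ M t ≤ t)
    (ha : ∀ x, 0 ≤ x → expMean lam M x ≤ a ∧
      a ≤ expMean lam M x + Real.exp (-lam * x) * (x + 1 / lam))
    {x : ℝ} (hx : 0 < x) :
    |renewalDefect lam M x - a| ≤ 4 * Real.exp (-lam) * Real.exp (-(x - 1) / 2) := by
  have hlam0 : 0 < lam := by linarith
  have hinv : 1 / lam ≤ 1 := by rw [div_le_one hlam0]; exact hlam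
  rcases le_total x 1 with hx1 | hx1
  · rw [h.renewalDefect_eq_zero hx hx1, zero_sub, abs_neg]
    have h1 := ha 1 zero_le_one
    rw [expMean_eq_zero h.1 zero_le_one le_rfl, mul_one] at h1
    rw [abs_of_nonneg h1.1]
    have he : 1 ≤ Real.exp (-(x - 1) / 2) := Real.one_le_exp (by linarith)
    have hp := Real.exp_pos (-lam)
    nlinarith
  · rw [h.renewalDefect_eq hM hlam0 hx]
    refine le_trans ?_ (exp_neg_mul_le hlam hx1)
    have h1 := ha x hx.le
    have h2 := hb (x + 1) (by linarith)
    have hp := Real.exp_pos (-lam * x)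
    rw [abs_le]
    constructor <;> nlinarith

theorem intervalIntegrable_renewalDefect {M : ℝ → ℝ} (hM : MonotoneOn M (Set.Ici 0)) (lam : ℝ)
    {X : ℝ} (hX : 0 ≤ X) : IntervalIntegrable (renewalDefect lam M) volume 0 X := by
  have h1 := (hM.intervalIntegrable_of_nonneg zero_le_one (by linarith : 0 ≤ X + 1)).comp_add_right 1
  simp only [sub_self, add_sub_cancel_right] at h1
  refine (h1.sub intervalIntegrable_const).sub (ContinuousOn.intervalIntegrable ?_)
  rw [Set.uIcc_of_le hX]
  exact continuousOn_expConv hM lam hX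

theorem integral_renewalDefect {M : ℝ → ℝ} (hmeas : Measurable M)
    (hM : MonotoneOn M (Set.Ici 0)) (h01 : ∀ x : ℝ, 0 ≤ x → x ≤ 1 → M x = 0)
    {lam X : ℝ} (hlam : lam ≠ 0) (hX : 0 ≤ X) :
    ∫ x in (0:ℝ)..X, renewalDefect lam M x =
      (∫ x in X..(X + 1), M x) + expConv lam M X / lam - X := by
  have h1 := (hM.intervalIntegrable_of_nonneg zero_le_one (by linarith : 0 ≤ X + 1)).comp_add_right 1
  simp only [sub_self, add_sub_cancel_right] at h1
  have hJ : IntervalIntegrable (expConv lam M) volume 0 X := by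
    refine ContinuousOn.intervalIntegrable ?_
    rw [Set.uIcc_of_le hX]
    exact continuousOn_expConv hM lam hX
  have hzero : ∫ x in (0:ℝ)..1, M x = 0 := by
    refine intervalIntegral.integral_zero_ae (Eventually.of_forall fun t ht => ?_)
    rw [Set.uIoc_of_le zero_le_one] at ht
    exact h01 t ht.1.le ht.2
  have hsplit1 := intervalIntegral.integral_add_adjacent_intervals
    (hM.intervalIntegrable_of_nonneg le_rfl zero_le_one)
    (hM.intervalIntegrable_of_nonneg zero_le_one (by linarith : 0 ≤ X + 1))
  have hsplit2 := intervalIntegral.integral_add_adjacent_intervals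
    (hM.intervalIntegrable_of_nonneg le_rfl hX)
    (hM.intervalIntegrable_of_nonneg hX (by linarith : 0 ≤ X + 1))
  unfold renewalDefect
  rw [intervalIntegral.integral_sub (h1.sub intervalIntegrable_const) hJ,
    intervalIntegral.integral_sub h1 intervalIntegrable_const,
    intervalIntegral.integral_comp_add_right, integral_expConv hmeas hM hlam hX,
    intervalIntegral.integral_const]
  simp only [zero_add, sub_zero, smul_eq_mul, mul_one]
  linarith

theorem abs_integral_le_of_exp_bound {f : ℝ → ℝ} {c X : ℝ} (hc : 0 ≤ c) (hX : 0 ≤ X)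
    (hf : ∀ x, 0 < x → |f x| ≤ c * Real.exp (-(x - 1) / 2)) :
    |∫ x in (0:ℝ)..X, f x| ≤ 4 * c := by
  have hd : ∀ t : ℝ, HasDerivAt (fun u => -2 * c * Real.exp (-(u - 1) / 2))
      (c * Real.exp (-(t - 1) / 2)) t := by
    intro t
    have h3 := ((((hasDerivAt_id t).sub_const 1).neg.div_const 2).exp).const_mul (-2 * c)
    refine h3.congr_deriv ?_
    simp only [id, Pi.neg_apply]
    ring
  have hint : IntervalIntegrable (fun t => c * Real.exp (-(t - 1) / 2)) volume 0 X :=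
    Continuous.intervalIntegrable (by fun_prop) _ _
  have h1 := intervalIntegral.norm_integral_le_of_norm_le (f := f) (μ := volume) hX
    (Eventually.of_forall fun t ht => hf t ht.1) hint
  rw [intervalIntegral.integral_eq_sub_of_hasDerivAt (fun t _ => hd t) hint] at h1
  rw [← Real.norm_eq_abs]
  refine h1.trans ?_
  have h2 : Real.exp (-((0:ℝ) - 1) / 2) ≤ 2 := by
    have h := Real.add_one_le_exp (-(1/2:ℝ))
    have h' : Real.exp (-((0:ℝ) - 1) / 2) * Real.exp (-(1/2:ℝ)) = 1 := by
      rw [← Real.exp_add]; norm_num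
    nlinarith [Real.exp_pos (-((0:ℝ) - 1) / 2)]
  have h3 := mul_nonneg hc (Real.exp_pos (-(X - 1) / 2)).le
  nlinarith

theorem tendsto_integral_unit_window {f : ℝ → ℝ} {B : ℝ}
    (hi : ∀ X, 0 ≤ X → IntervalIntegrable f volume X (X + 1)) (hf : Tendsto f atTop (nhds B)) :
    Tendsto (fun X => ∫ x in X..(X + 1), f x) atTop (nhds B) := by
  rw [Metric.tendsto_atTop] at hf ⊢
  intro ε hε
  obtain ⟨N, hN⟩ := hf (ε / 2) (half_pos hε)
  refine ⟨max N 0, fun X hX => ?_⟩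
  have hsub : (∫ x in X..(X + 1), f x) - B = ∫ x in X..(X + 1), (f x - B) := by
    rw [intervalIntegral.integral_sub (hi X ((le_max_right _ _).trans hX))
      intervalIntegrable_const, intervalIntegral.integral_const]
    simp
  rw [Real.dist_eq, hsub, ← Real.norm_eq_abs]
  have h := intervalIntegral.norm_integral_le_of_norm_le_const (a := X) (b := X + 1)
    (f := fun x => f x - B) (C := ε / 2) fun x hx => by
      rw [Set.uIoc_of_le (by linarith)] at hx
      have := hN x (((le_max_left _ _).trans hX).trans hx.1.le)
      rw [Real.dist_eq] at this
      exact this.le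
  simp only [add_sub_cancel_left, abs_one, mul_one] at h
  linarith

theorem eq_zero_of_tendsto_bounded_sub_mul {E : ℝ → ℝ} {k L c : ℝ}
    (hE : ∀ X, 0 ≤ X → |E X| ≤ c)
    (h : Tendsto (fun X => E X - k * X) atTop (nhds L)) : k = 0 := by
  have h1 : Tendsto (fun X => (E X - k * X) / X) atTop (nhds 0) := h.div_atTop tendsto_id
  have h2 : Tendsto (fun X => E X / X) atTop (nhds 0) := by
    refine tendsto_bdd_div_atTop_nhds_zero (b := -c) (B := c) ?_ ?_ tendsto_id
    · filter_upwards [eventually_ge_atTop 0] with X hX using (abs_le.mp (hE X hX)).1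
    · filter_upwards [eventually_ge_atTop 0] with X hX using (abs_le.mp (hE X hX)).2
  have h3 := h2.sub h1
  rw [sub_zero] at h3
  refine tendsto_nhds_unique (tendsto_const_nhds.congr' ?_) h3
  filter_upwards [eventually_gt_atTop 0] with X hX
  field_simp
  ring

/-- **Asymptotic formula (21) of the paper.**
`B_λ = -1/2 + 1/(λ+1) + 1/(2(λ+1)²) + O(e^{-λ})` as `λ → ∞`. -/
theorem expParking_second_constant_asymptotics :
    ∃ K : ℝ, 0 < K ∧ ∃ lam0 : ℝ, 0 < lam0 ∧
      ∀ lam : ℝ, lam0 ≤ lam → ∀ M : ℝ → ℝ,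
        Measurable M → MonotoneOn M (Set.Ici 0) →
        SatisfiesExpParkingEq lam M →
        (∀ x : ℝ, 0 < x → (⌈(x - 1) / 2⌉ : ℝ) ≤ M x ∧ M x ≤ (⌊x⌋ : ℝ)) →
        ∀ Cl Bl : ℝ,
          Tendsto (fun x : ℝ => M x / x) atTop (nhds Cl) →
          Tendsto (fun x : ℝ => M x - Cl * x) atTop (nhds Bl) →
          |Bl - (-(1 / 2) + 1 / (lam + 1) + 1 / (2 * (lam + 1) ^ 2))|
            ≤ K * Real.exp (-lam) := by
  refine ⟨18, by norm_num, 1, one_pos, ?_⟩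
  intro lam hlam M hmeas hM hpark hbounds C B hC hB
  have hlam0 : 0 < lam := by linarith
  have hb : ∀ t, 0 ≤ t → 0 ≤ M t ∧ M t ≤ t := by
    intro t ht
    have h0 := hpark.1 0 le_rfl zero_le_one
    refine ⟨h0 ▸ hM (Set.mem_Ici.mpr le_rfl) (Set.mem_Ici.mpr ht) ht, ?_⟩
    rcases ht.eq_or_lt with rfl | ht
    · exact h0.le
    · exact (hbounds t ht).2.trans (Int.floor_le t)
  obtain ⟨a, ha⟩ := exists_expMean_limit hlam0 hM hb
  have hG := fun x (hx : 0 < x) => hpark.abs_renewalDefect_sub_le hM hlam hb ha hx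
  have hexp := Real.exp_pos (-lam)
  have ha1 := ha 1 zero_le_one
  rw [expMean_eq_zero hpark.1 zero_le_one le_rfl, mul_one] at ha1
  have ha2 : a ≤ 2 * Real.exp (-lam) := by
    have hinv : 1 / lam ≤ 1 := by rw [div_le_one hlam0]; exact hlam
    nlinarith
  have hE : ∀ X, 0 ≤ X →
      |∫ x in (0:ℝ)..X, (renewalDefect lam M x - a)| ≤ 16 * Real.exp (-lam) := by
    intro X hX
    have := abs_integral_le_of_exp_bound (by positivity) hX hG
    linarith
  have hGlim : Tendsto (renewalDefect lam M) atTop (nhds a) := by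
    have hdecay : Tendsto (fun x : ℝ => 4 * Real.exp (-lam) * Real.exp (-(x - 1) / 2))
        atTop (nhds 0) := by
      have h1 : Tendsto (fun x : ℝ => -(x - 1) / 2) atTop atBot := by
        refine Tendsto.atBot_div_const two_pos (tendsto_neg_atTop_atBot.comp ?_)
        exact tendsto_atTop_add_const_right _ _ tendsto_id
      simpa using (Real.tendsto_exp_atBot.comp h1).const_mul (4 * Real.exp (-lam))
    rw [tendsto_iff_norm_sub_tendsto_zero]
    refine squeeze_zero' (Eventually.of_forall fun _ => norm_nonneg _) ?_ hdecay
    filter_upwards [eventually_gt_atTop 0] with x hx using hG x hx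
  have hwin : Tendsto (fun X => ∫ x in X..(X + 1), (M x - C * x)) atTop (nhds B) :=
    tendsto_integral_unit_window (fun X hX =>
      (hM.intervalIntegrable_of_nonneg hX (by linarith)).sub
        (Continuous.intervalIntegrable (by fun_prop) _ _)) hB
  have hshift : Tendsto (fun X => M (X + 1) - C * (X + 1)) atTop (nhds B) :=
    hB.comp (tendsto_atTop_add_const_right _ _ tendsto_id)
  have hlim : Tendsto (fun X => (∫ x in (0:ℝ)..X, (renewalDefect lam M x - a)) -
      (C * (1 + 1 / lam) - 1 - a) * X) atTop
      (nhds (B + C / 2 + (B + C - 1 - a) / lam)) := by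
    have h := (hwin.add_const (C / 2)).add
      ((((hshift.add_const C).sub_const 1).sub hGlim).div_const lam)
    refine h.congr' ?_
    filter_upwards [eventually_ge_atTop 0] with X hX
    rw [intervalIntegral.integral_sub (intervalIntegrable_renewalDefect hM lam hX)
      intervalIntegrable_const, integral_renewalDefect hmeas hM hpark.1 hlam0.ne' hX,
      intervalIntegral.integral_sub (hM.intervalIntegrable_of_nonneg hX (by linarith))
      (Continuous.intervalIntegrable (by fun_prop) _ _), intervalIntegral.integral_const_mul,
      integral_id, intervalIntegral.integral_const, renewalDefect]
    simp only [sub_zero, smul_eq_mul]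
    field_simp
    ring
  have hk := eq_zero_of_tendsto_bounded_sub_mul hE hlim
  simp only [hk, zero_mul, sub_zero] at hlim
  have hL : |B + C / 2 + (B + C - 1 - a) / lam| ≤ 16 * Real.exp (-lam) := by
    refine le_of_tendsto hlim.abs ?_
    filter_upwards [eventually_ge_atTop 0] with X hX using hE X hX
  set L := B + C / 2 + (B + C - 1 - a) / lam with hLdef
  set T := -(1 / 2) + 1 / (lam + 1) + 1 / (2 * (lam + 1) ^ 2) with hT
  have hl1 : lam + 1 ≠ 0 := by positivity
  have hCval : C = (1 + a) * lam / (lam + 1) := by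
    field_simp at hk ⊢
    linarith
  have hBval : B - T = lam / (lam + 1) * L + a * T := by
    rw [hLdef, hT, hCval]
    field_simp
    ring
  have hu0 : 0 ≤ lam / (lam + 1) := by positivity
  have hu1 : lam / (lam + 1) ≤ 1 := by rw [div_le_one (by positivity)]; linarith
  have hTabs : |T| ≤ 1 := by
    have hp : 0 ≤ 1 / (lam + 1) := by positivity
    have hp' : 1 / (lam + 1) ≤ 1 / 2 := by
      apply one_div_le_one_div_of_le <;> linarith
    have hsq : 1 / (2 * (lam + 1) ^ 2) = (1 / (lam + 1)) ^ 2 / 2 := by field_simp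
    rw [hT, hsq, abs_le]
    constructor <;> nlinarith
  calc |B - T| ≤ |lam / (lam + 1) * L| + |a * T| := hBval ▸ abs_add_le _ _
    _ = lam / (lam + 1) * |L| + a * |T| := by
      rw [abs_mul, abs_mul, abs_of_nonneg hu0, abs_of_nonneg ha1.1]
    _ ≤ 1 * (16 * Real.exp (-lam)) + 2 * Real.exp (-lam) * 1 := by
      gcongr
    _ = 18 * Real.exp (-lam) := by ring
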